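/- arXiv:1901.10791 — 2 statements merged into one kernel-verified Lean document; each statement's English description precedes it below -/
import Mathlib

section
/- Let F : ℝ^{n×n} → ℝ be twice continuously differentiable with gradient Lipschitz continuous with constant L_F (with respect to the Frobenius norm), and define f : ℝ^{n×r} → ℝ by f(X) = F(XXᵀ). Then for all X, U ∈ ℝ^{n×r}, the second derivative of f satisfies ∇²f(X)[U,U] ≤ 6·L_F·‖X‖²‖U‖² + 2·‖∇F(0)‖·‖U‖². -/
open Matrix

attribute [local instance] Matrix.frobeniusNormedAddCommGroup Matrix.frobeniusNormedSpace

/-- Frobenius inner product `⟨X, Y⟩ = Tr(Xᵀ Y)`. -/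
noncomputable def minner {n r : ℕ} (X Y : Matrix (Fin n) (Fin r) ℝ) : ℝ := (Xᵀ * Y).trace

/-- The continuous linear functional `U ↦ ⟨W, U⟩` (Frobenius inner product with `W`). -/
noncomputable def innerCLM {n r : ℕ} (W : Matrix (Fin n) (Fin r) ℝ) :
    Matrix (Fin n) (Fin r) ℝ →L[ℝ] ℝ :=
  LinearMap.toContinuousLinearMap
    { toFun := fun U => minner W U
      map_add' := by intro U V; simp [minner, Matrix.mul_add]
      map_smul' := by intro c U; simp [minner, Matrix.mul_smul] }

theorem minner_le_aux {n r : ℕ} (X Y : Matrix (Fin n) (Fin r) ℝ) : minner X Y ≤ ‖X‖ * ‖Y‖ := by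
  have h : minner X Y = ∑ p : Fin n × Fin r, X p.1 p.2 * Y p.1 p.2 := by
    rw [Fintype.sum_prod_type, Finset.sum_comm]
    simp [minner, Matrix.trace, Matrix.mul_apply]
  have hn : ∀ Z : Matrix (Fin n) (Fin r) ℝ, ‖Z‖ = √(∑ p : Fin n × Fin r, Z p.1 p.2 ^ 2) := by
    intro Z
    rw [Matrix.frobenius_norm_def, Fintype.sum_prod_type, Real.sqrt_eq_rpow]
    simp
  rw [h, hn, hn]
  exact Real.sum_mul_le_sqrt_mul_sqrt _ _ _

/-- If `F` is twice continuously differentiable with gradient `F'` Lipschitz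
with constant `L_F` (Frobenius norm) and `f(X) = F(XXᵀ)`, then the second derivative of `f`
in any direction `U` (i.e. the second derivative at `t = 0` of `t ↦ f(X + tU)`) satisfies
`∇²f(X)[U,U] ≤ 6 L_F ‖X‖²‖U‖² + 2‖∇F(0)‖‖U‖²`. -/
theorem factored_second_derivative_bound {n r : ℕ}
    (F : Matrix (Fin n) (Fin n) ℝ → ℝ)
    (F' : Matrix (Fin n) (Fin n) ℝ → Matrix (Fin n) (Fin n) ℝ)
    (f : Matrix (Fin n) (Fin r) ℝ → ℝ)
    (L_F : ℝ) (hLF : 0 ≤ L_F)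
    (hFsmooth : ContDiff ℝ 2 F)
    (hFgrad : ∀ Y, HasFDerivAt F (innerCLM (F' Y)) Y)
    (hFlip : ∀ Y₁ Y₂, ‖F' Y₁ - F' Y₂‖ ≤ L_F * ‖Y₁ - Y₂‖)
    (hfdef : ∀ X, f X = F (X * Xᵀ)) :
    ∀ X U : Matrix (Fin n) (Fin r) ℝ,
      iteratedDeriv 2 (fun t : ℝ => f (X + t • U)) 0 ≤
        6 * L_F * ‖X‖ ^ 2 * ‖U‖ ^ 2 + 2 * ‖F' 0‖ * ‖U‖ ^ 2 := by
  intro X U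
  set A := X * Xᵀ with hA
  set B := X * Uᵀ + U * Xᵀ with hB
  set C := U * Uᵀ with hC
  have hXT : ‖Xᵀ‖ = ‖X‖ := Matrix.frobenius_norm_transpose X
  have hUT : ‖Uᵀ‖ = ‖U‖ := Matrix.frobenius_norm_transpose U
  have nA : ‖A‖ ≤ ‖X‖ ^ 2 := by
    have := Matrix.frobenius_norm_mul X Xᵀ
    rw [hXT] at this
    rw [sq]; exact this
  have nC : ‖C‖ ≤ ‖U‖ ^ 2 := by
    have := Matrix.frobenius_norm_mul U Uᵀ
    rw [hUT] at this
    rw [sq]; exact this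
  have nB : ‖B‖ ≤ 2 * (‖X‖ * ‖U‖) := by
    have h1 := Matrix.frobenius_norm_mul X Uᵀ
    have h2 := Matrix.frobenius_norm_mul U Xᵀ
    rw [hUT] at h1
    rw [hXT] at h2
    have h3 := norm_add_le (X * Uᵀ) (U * Xᵀ)
    rw [hB]; linarith
  have hc : (fun t : ℝ => f (X + t • U)) = fun t : ℝ => F (A + t • B + t ^ 2 • C) := by
    funext t
    rw [hfdef]
    congr 1
    simp only [hA, hB, hC, Matrix.transpose_add, Matrix.transpose_smul, Matrix.add_mul,
      Matrix.mul_add, Matrix.smul_mul, Matrix.mul_smul, smul_add, smul_smul, sq]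
    abel
  have hd : ∀ t : ℝ, HasDerivAt (fun t : ℝ => F (A + t • B + t ^ 2 • C))
      (minner (F' (A + t • B + t ^ 2 • C)) (B + (2 * t) • C)) t := by
    intro t
    have h1 : HasDerivAt (fun t : ℝ => A + t • B + t ^ 2 • C) (B + (2 * t) • C) t := by
      have h2 := ((hasDerivAt_id t).smul_const B).const_add A
      have h3 := ((hasDerivAt_id t).pow 2).smul_const C
      exact (h2.add h3).congr_deriv (by simp)
    exact (hFgrad _).comp_hasDerivAt t h1
  have hderiv : deriv (fun t : ℝ => F (A + t • B + t ^ 2 • C)) =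
      fun t => minner (F' (A + t • B + t ^ 2 • C)) (B + (2 * t) • C) :=
    funext fun t => (hd t).deriv
  rw [hc, iteratedDeriv_succ, iteratedDeriv_one, hderiv]
  set g : ℝ → ℝ := fun t => minner (F' (A + t • B + t ^ 2 • C)) (B + (2 * t) • C) with hg
  by_cases hdiff : DifferentiableAt ℝ g 0
  swap
  · rw [deriv_zero_of_not_differentiableAt hdiff]
    positivity
  have hlim := hdiff.hasDerivAt.tendsto_slope_zero_right
  have hF : ‖F' A‖ ≤ ‖F' 0‖ + L_F * ‖X‖ ^ 2 := by
    have h1 := hFlip A 0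
    rw [sub_zero] at h1
    have h2 : ‖F' A‖ ≤ ‖F' A - F' 0‖ + ‖F' 0‖ := by
      simpa using norm_add_le (F' A - F' 0) (F' 0)
    have h3 := mul_le_mul_of_nonneg_left nA hLF
    linarith
  have hbound : ∀ t : ℝ, 0 < t → t⁻¹ • (g (0 + t) - g 0) ≤
      L_F * ‖B + t • C‖ * ‖B + (2 * t) • C‖ + 2 * (‖F' A‖ * ‖C‖) := by
    intro t ht
    have e : g (0 + t) - g 0 = minner (F' (A + t • B + t ^ 2 • C) - F' A) (B + (2 * t) • C)
        + 2 * t * minner (F' A) C := by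
      simp [hg, minner, Matrix.sub_mul, Matrix.mul_add]
      ring
    have h1 := minner_le_aux (F' (A + t • B + t ^ 2 • C) - F' A) (B + (2 * t) • C)
    have h2 := minner_le_aux (F' A) C
    have h3 := hFlip (A + t • B + t ^ 2 • C) A
    have h4 : A + t • B + t ^ 2 • C - A = t • (B + t • C) := by
      rw [smul_add t B, smul_smul, sq]; abel
    rw [h4, norm_smul, Real.norm_of_nonneg ht.le] at h3
    have h5 := mul_le_mul_of_nonneg_right h3 (norm_nonneg (B + (2 * t) • C))
    have h6 := mul_le_mul_of_nonneg_left h2 (by positivity : 0 ≤ 2 * t)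
    rw [smul_eq_mul, inv_mul_le_iff₀ ht, e]
    linarith
  have hcont : Filter.Tendsto (fun t : ℝ =>
      L_F * ‖B + t • C‖ * ‖B + (2 * t) • C‖ + 2 * (‖F' A‖ * ‖C‖)) (nhdsWithin 0 (Set.Ioi 0))
      (nhds (L_F * ‖B‖ * ‖B‖ + 2 * (‖F' A‖ * ‖C‖))) := by
    have h : Continuous (fun t : ℝ =>
      L_F * ‖B + t • C‖ * ‖B + (2 * t) • C‖ + 2 * (‖F' A‖ * ‖C‖)) := by fun_prop
    have := h.tendsto 0
    simp only [mul_zero, zero_smul, add_zero] at this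
    exact this.mono_left nhdsWithin_le_nhds
  have key := le_of_tendsto_of_tendsto hlim hcont
    (by filter_upwards [self_mem_nhdsWithin] with t ht using hbound t ht)
  have k1 : L_F * ‖B‖ * ‖B‖ ≤ L_F * (2 * (‖X‖ * ‖U‖)) * (2 * (‖X‖ * ‖U‖)) := by gcongr
  have k2 : ‖F' A‖ * ‖C‖ ≤ (‖F' 0‖ + L_F * ‖X‖ ^ 2) * ‖U‖ ^ 2 := by gcongr
  linarith
end

section
/- Let α, σ > 0, let V ∈ ℝ^{n×r}, and let τ ∈ ℝ with τ ≥ σ satisfy τ²(τ − σ) = α‖V‖². Then W* = (1/τ)·V is the unique global minimizer over ℝ^{n×r} of the function W ↦ h_u(W) − ⟨V, W⟩, where h_u(W) = (α/4)‖W‖⁴ + (σ/2)‖W‖². Consequently, in the unconstrained case (g ≡ 0), the Bregman iteration map of h_u at X with step size λ is T_λ(X) = U / τ_σ(α‖U‖²) with U = ∇h_u(X) − λ∇f(X) = (α‖X‖² + σ)X − λ∇f(X). -/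
open Matrix

attribute [local instance] Matrix.frobeniusNormedAddCommGroup Matrix.frobeniusNormedSpace

/-- The universal kernel `h_u(X) = (α/4)‖X‖⁴ + (σ/2)‖X‖²` (Frobenius norm). -/
noncomputable def hu {n r : ℕ} (α σ : ℝ) (X : Matrix (Fin n) (Fin r) ℝ) : ℝ :=
  α / 4 * ‖X‖ ^ 4 + σ / 2 * ‖X‖ ^ 2

lemma minner_eq_aux {n r : ℕ} (X Y : Matrix (Fin n) (Fin r) ℝ) :
    minner X Y = ∑ j, ∑ i, X i j * Y i j := by
  simp [minner, Matrix.trace, Matrix.mul_apply]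

lemma minner_sub_right_aux {n r : ℕ} (X Y Z : Matrix (Fin n) (Fin r) ℝ) :
    minner X (Y - Z) = minner X Y - minner X Z := by
  simp [minner, Matrix.mul_sub]

lemma minner_sub_left_aux {n r : ℕ} (X Y Z : Matrix (Fin n) (Fin r) ℝ) :
    minner (X - Y) Z = minner X Z - minner Y Z := by
  simp [minner, Matrix.sub_mul]

lemma minner_smul_left_aux {n r : ℕ} (c : ℝ) (X Y : Matrix (Fin n) (Fin r) ℝ) :
    minner (c • X) Y = c * minner X Y := by
  simp [minner]

lemma minner_comm_aux {n r : ℕ} (X Y : Matrix (Fin n) (Fin r) ℝ) :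
    minner X Y = minner Y X := by
  simp only [minner_eq_aux, mul_comm]

lemma norm_sq_aux {n r : ℕ} (X : Matrix (Fin n) (Fin r) ℝ) :
    ‖X‖ ^ 2 = minner X X := by
  rw [minner_eq_aux, Matrix.frobenius_norm_def, ← Real.sqrt_eq_rpow, Real.sq_sqrt (by positivity),
    Finset.sum_comm]
  simp [sq]

lemma key_aux {n r : ℕ} (α σ : ℝ) (hσ : 0 < σ) (V : Matrix (Fin n) (Fin r) ℝ) (τ : ℝ)
    (hτ : σ ≤ τ) (h : τ ^ 2 * (τ - σ) = α * ‖V‖ ^ 2) (W : Matrix (Fin n) (Fin r) ℝ) :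
    (hu α σ W - minner V W) - (hu α σ (τ⁻¹ • V) - minner V (τ⁻¹ • V)) =
      α / 4 * (‖W‖ ^ 2 - ‖τ⁻¹ • V‖ ^ 2) ^ 2 + τ / 2 * ‖W - τ⁻¹ • V‖ ^ 2 := by
  have ht : 0 < τ := lt_of_lt_of_le hσ hτ
  obtain ⟨S, hS⟩ : ∃ S, S = τ⁻¹ • V := ⟨_, rfl⟩
  have hV : V = τ • S := by rw [hS, smul_smul, mul_inv_cancel₀ ht.ne', one_smul]
  rw [← hS]
  have h2 : τ - σ = α * ‖S‖ ^ 2 := by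
    rw [hV, norm_smul, mul_pow, Real.norm_eq_abs, sq_abs] at h
    have : τ ^ 2 ≠ 0 := by positivity
    apply mul_left_cancel₀ this
    linarith
  have hd : ‖W - S‖ ^ 2 = ‖W‖ ^ 2 + ‖S‖ ^ 2 - 2 * minner S W := by
    simp only [norm_sq_aux, minner_sub_left_aux, minner_sub_right_aux]
    rw [minner_comm_aux W S]; ring
  rw [hd, hV, minner_smul_left_aux, minner_smul_left_aux, ← norm_sq_aux]
  unfold hu
  have h3 : σ = τ - α * ‖S‖ ^ 2 := by linarith
  rw [h3]; ring

lemma key_min_aux {n r : ℕ} (α σ : ℝ) (hα : 0 < α) (hσ : 0 < σ) (V : Matrix (Fin n) (Fin r) ℝ)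
    (τ : ℝ) (hτ : σ ≤ τ) (h : τ ^ 2 * (τ - σ) = α * ‖V‖ ^ 2) :
    (∀ W, hu α σ (τ⁻¹ • V) - minner V (τ⁻¹ • V) ≤ hu α σ W - minner V W) ∧
      (∀ W, hu α σ W - minner V W ≤ hu α σ (τ⁻¹ • V) - minner V (τ⁻¹ • V) →
        W = τ⁻¹ • V) := by
  have ht : 0 < τ := lt_of_lt_of_le hσ hτ
  refine ⟨fun W => ?_, fun W hW => ?_⟩
  · have := key_aux α σ hσ V τ hτ h W
    have h1 : 0 ≤ α / 4 * (‖W‖ ^ 2 - ‖τ⁻¹ • V‖ ^ 2) ^ 2 := by positivity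
    have h2 : 0 ≤ τ / 2 * ‖W - τ⁻¹ • V‖ ^ 2 := by positivity
    linarith
  · have := key_aux α σ hσ V τ hτ h W
    have h1 : 0 ≤ α / 4 * (‖W‖ ^ 2 - ‖τ⁻¹ • V‖ ^ 2) ^ 2 := by positivity
    by_contra hne
    have h3 : 0 < ‖W - τ⁻¹ • V‖ := norm_pos_iff.mpr (sub_ne_zero.mpr hne)
    have h2 : 0 < τ / 2 * ‖W - τ⁻¹ • V‖ ^ 2 := by positivity
    linarith

/-- Bregman iteration map of `h_u`, unconstrained case.
If `τ ≥ σ` satisfies `τ²(τ − σ) = α‖V‖²` (i.e. `τ = τ_σ(α‖V‖²)`), then `(1/τ)V` is the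
unique global minimizer of `W ↦ h_u(W) − ⟨V, W⟩`.  Consequently, for `g ≡ 0`, the Bregman
iteration map is `T_λ(X) = U / τ_σ(α‖U‖²)` with
`U = ∇h_u(X) − λ∇f(X) = (α‖X‖² + σ)X − λ∇f(X)`:  `U / τ_σ(α‖U‖²)` is the unique minimizer of
`W ↦ ⟨∇f(X), W − X⟩ + (1/λ) D_{h_u}(W, X)`. -/
theorem bregman_map_universal_kernel_unconstrained {n r : ℕ} (α σ : ℝ)
    (hα : 0 < α) (hσ : 0 < σ) :
    (∀ (V : Matrix (Fin n) (Fin r) ℝ) (τ : ℝ), σ ≤ τ → τ ^ 2 * (τ - σ) = α * ‖V‖ ^ 2 →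
      (∀ W, hu α σ (τ⁻¹ • V) - minner V (τ⁻¹ • V) ≤ hu α σ W - minner V W) ∧
      (∀ W, hu α σ W - minner V W ≤ hu α σ (τ⁻¹ • V) - minner V (τ⁻¹ • V) →
        W = τ⁻¹ • V)) ∧
    (∀ (X G : Matrix (Fin n) (Fin r) ℝ) (lam τ : ℝ), 0 < lam →
      ∀ U : Matrix (Fin n) (Fin r) ℝ, U = (α * ‖X‖ ^ 2 + σ) • X - lam • G →
      σ ≤ τ → τ ^ 2 * (τ - σ) = α * ‖U‖ ^ 2 →
      (∀ W, minner G (τ⁻¹ • U - X) +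
          (1 / lam) * (hu α σ (τ⁻¹ • U) - hu α σ X -
            minner ((α * ‖X‖ ^ 2 + σ) • X) (τ⁻¹ • U - X)) ≤
        minner G (W - X) +
          (1 / lam) * (hu α σ W - hu α σ X -
            minner ((α * ‖X‖ ^ 2 + σ) • X) (W - X))) ∧
      (∀ W, minner G (W - X) +
          (1 / lam) * (hu α σ W - hu α σ X -
            minner ((α * ‖X‖ ^ 2 + σ) • X) (W - X)) ≤
        minner G (τ⁻¹ • U - X) +
          (1 / lam) * (hu α σ (τ⁻¹ • U) - hu α σ X -
            minner ((α * ‖X‖ ^ 2 + σ) • X) (τ⁻¹ • U - X)) →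
        W = τ⁻¹ • U)) := by
  refine ⟨fun V τ hτ h => key_min_aux α σ hα hσ V τ hτ h, ?_⟩
  intro X G lam τ hl U hU hτ h
  obtain ⟨m1, m2⟩ := key_min_aux α σ hα hσ U τ hτ h
  have e : ∀ W, minner G (W - X) + (1 / lam) * (hu α σ W - hu α σ X -
            minner ((α * ‖X‖ ^ 2 + σ) • X) (W - X)) =
      (1 / lam) * (hu α σ W - minner U W) + (1 / lam) * (minner U X - hu α σ X) := by
    intro W
    have hG : lam * minner G (W - X) =
        minner ((α * ‖X‖ ^ 2 + σ) • X) (W - X) - minner U (W - X) := by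
      rw [hU, minner_sub_left_aux, minner_smul_left_aux lam]; ring
    have hs := minner_sub_right_aux U W X
    field_simp
    linarith
  have hl' : 0 < 1 / lam := by positivity
  refine ⟨fun W => ?_, fun W hW => m2 W ?_⟩
  · rw [e, e]
    have := mul_le_mul_of_nonneg_left (m1 W) hl'.le
    linarith
  · rw [e, e] at hW
    exact le_of_mul_le_mul_left (by linarith) hl'
end
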